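/- Let (B,W) be a polygonal coloring of the plane with boundary ∂ satisfying condition (C3), and let A be a feasible point. Let ρ denote the rotation of ℝ² by angle π/3 about the point A. Then for every point P with dist(A,P) = 1: P ∈ ∂ if and only if ρ(P) ∈ ∂. -/

import Mathlib

open scoped RealInnerProductSpace

noncomputable section

/-- `l` is an (affine) line in the plane: a nonempty one-dimensional affine subspace. -/
def IsLine (l : AffineSubspace ℝ (EuclideanSpace ℝ (Fin 2))) : Prop :=
  (l : Set (EuclideanSpace ℝ (Fin 2))).Nonempty ∧ Module.finrank ℝ l.direction = 1

/-- A boundary segment: a closed convex subset of some affine line, containing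
more than one point (it may be a segment, a ray, or a full line). -/
def IsSeg (s : Set (EuclideanSpace ℝ (Fin 2))) : Prop :=
  IsClosed s ∧ Convex ℝ s ∧ s.Nontrivial ∧
    ∃ l : AffineSubspace ℝ (EuclideanSpace ℝ (Fin 2)), IsLine l ∧ s ⊆ (l : Set _)

/-- `x` is an endpoint of the segment `s`: a point of `s` not in its relative
(intrinsic) interior. -/
def IsEndpoint (x : EuclideanSpace ℝ (Fin 2)) (s : Set (EuclideanSpace ℝ (Fin 2))) : Prop :=
  x ∈ s ∧ x ∉ intrinsicInterior ℝ s

/-- The coloring `(B, Bᶜ)` is polygonal, with set of boundary segments `S`. -/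
structure IsPolygonal (B : Set (EuclideanSpace ℝ (Fin 2)))
    (S : Set (Set (EuclideanSpace ℝ (Fin 2)))) : Prop where
  /-- The black points lie in the closure of the black interior. -/
  black_sub : B ⊆ closure (interior B)
  /-- The white points lie in the closure of the white interior. -/
  white_sub : Bᶜ ⊆ closure (interior Bᶜ)
  /-- Every member of `S` is a boundary segment. -/
  seg : ∀ s ∈ S, IsSeg s
  /-- The boundary of the coloring is the union of the boundary segments. -/
  boundary : frontier B = ⋃₀ S
  /-- Two distinct boundary segments meet in at most one point. -/
  inter_subsingleton : ∀ s ∈ S, ∀ t ∈ S, s ≠ t → (s ∩ t).Subsingleton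
  /-- A common point of two distinct boundary segments is an endpoint of both. -/
  inter_endpoint : ∀ s ∈ S, ∀ t ∈ S, s ≠ t → ∀ x ∈ s ∩ t, IsEndpoint x s ∧ IsEndpoint x t
  /-- No two distinct boundary segments sharing a common point lie on a common line. -/
  no_common_line : ∀ s ∈ S, ∀ t ∈ S, s ≠ t → (s ∩ t).Nonempty →
      ¬∃ l : AffineSubspace ℝ (EuclideanSpace ℝ (Fin 2)),
        IsLine l ∧ s ⊆ (l : Set _) ∧ t ⊆ (l : Set _)
  /-- Every bounded region meets only finitely many boundary segments. -/
  loc_finite : ∀ R : Set (EuclideanSpace ℝ (Fin 2)), Bornology.IsBounded R →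
      {s ∈ S | (s ∩ R).Nonempty}.Finite

/-- Condition (C3): every monochromatic unit triangle has a vertex on the boundary. -/
def C3 (B : Set (EuclideanSpace ℝ (Fin 2))) : Prop :=
  ∀ X Y Z : EuclideanSpace ℝ (Fin 2),
    dist X Y = 1 → dist Y Z = 1 → dist Z X = 1 →
    ((X ∈ B ∧ Y ∈ B ∧ Z ∈ B) ∨ (X ∉ B ∧ Y ∉ B ∧ Z ∉ B)) →
    X ∈ frontier B ∨ Y ∈ frontier B ∨ Z ∈ frontier B

/-- `x` is a boundary vertex: an endpoint of some boundary segment. -/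
def IsVertex (S : Set (Set (EuclideanSpace ℝ (Fin 2)))) (x : EuclideanSpace ℝ (Fin 2)) : Prop :=
  ∃ s ∈ S, IsEndpoint x s

/-- A boundary point `A` is feasible if it is not a boundary vertex and the unit
circle centered at `A` contains no boundary vertex. -/
def Feasible (B : Set (EuclideanSpace ℝ (Fin 2))) (S : Set (Set (EuclideanSpace ℝ (Fin 2))))
    (A : EuclideanSpace ℝ (Fin 2)) : Prop :=
  A ∈ frontier B ∧ ¬IsVertex S A ∧ ∀ P ∈ Metric.sphere A 1, ¬IsVertex S P

/-- Two segments are parallel: any lines containing them have the same direction. -/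
def SegParallel (s t : Set (EuclideanSpace ℝ (Fin 2))) : Prop :=
  ∀ l₁ l₂ : AffineSubspace ℝ (EuclideanSpace ℝ (Fin 2)),
    IsLine l₁ → IsLine l₂ → s ⊆ (l₁ : Set _) → t ⊆ (l₂ : Set _) →
    l₁.direction = l₂.direction

end

/-- Rotation of a vector of the plane by angle `θ` counterclockwise about the origin. -/
noncomputable def rotVec (θ : ℝ) (v : EuclideanSpace ℝ (Fin 2)) : EuclideanSpace ℝ (Fin 2) :=
  (WithLp.equiv 2 (Fin 2 → ℝ)).symm
    ![Real.cos θ * v 0 - Real.sin θ * v 1, Real.sin θ * v 0 + Real.cos θ * v 1]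

noncomputable section

open Real

section

open Filter Topology

/-- The point of the unit circle at angle `θ`. -/
def circlePt (θ : ℝ) : ℝ × ℝ := (cos θ, sin θ)

/-- Near `q`, the open sides of the line through `q` with normal vector `n` lie in `U` (the side
`n` points to) and in `V` respectively. -/
def SplitsAt (U V : Set (ℝ × ℝ)) (n q : ℝ × ℝ) : Prop :=
  n ≠ 0 ∧ ∀ᶠ r in 𝓝 q,
    (0 < n.1 * (r.1 - q.1) + n.2 * (r.2 - q.2) → r ∈ U) ∧
    (n.1 * (r.1 - q.1) + n.2 * (r.2 - q.2) < 0 → r ∈ V)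

/-- The circle point at angle `θ` enters `U` when it is moved with translation velocity `d` and
angular velocity `ω`. -/
def MovesInto (U : Set (ℝ × ℝ)) (θ : ℝ) (d : ℝ × ℝ) (ω : ℝ) : Prop :=
  ∀ᶠ δ in 𝓝[>] (0 : ℝ), δ • d + circlePt (θ + δ * ω) ∈ U

lemma continuous_circlePt : Continuous circlePt := by
  unfold circlePt; fun_prop

lemma tendsto_move (θ : ℝ) (d : ℝ × ℝ) (ω : ℝ) :
    Tendsto (fun δ : ℝ => δ • d + circlePt (θ + δ * ω)) (𝓝[>] 0) (𝓝 (circlePt θ)) := by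
  have h : Continuous (fun δ : ℝ => δ • d + circlePt (θ + δ * ω)) := by
    have := continuous_circlePt
    fun_prop
  have h0 := h.tendsto 0
  simp only [zero_smul, zero_mul, add_zero, zero_add] at h0
  exact h0.mono_left nhdsWithin_le_nhds

lemma SplitsAt.symm {U V : Set (ℝ × ℝ)} {n q : ℝ × ℝ} (h : SplitsAt U V n q) :
    SplitsAt V U (-n) q := by
  refine ⟨neg_ne_zero.2 h.1, h.2.mono fun r hr => ⟨fun h' => hr.2 ?_, fun h' => hr.1 ?_⟩⟩ <;>
  · simp only [Prod.fst_neg, Prod.snd_neg] at h'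
    linarith

lemma SplitsAt.normal_pos {U V : Set (ℝ × ℝ)} {n q : ℝ × ℝ} (h : SplitsAt U V n q) :
    0 < n.1 * n.1 + n.2 * n.2 := by
  have := h.1
  contrapose! this
  ext <;> simp <;> nlinarith [mul_self_nonneg n.1, mul_self_nonneg n.2]

lemma SplitsAt.smul {U V : Set (ℝ × ℝ)} {n q : ℝ × ℝ} (h : SplitsAt U V n q) {c : ℝ}
    (hc : 0 < c) : SplitsAt U V (c • n) q := by
  refine ⟨smul_ne_zero hc.ne' h.1, h.2.mono fun r hr => ⟨fun h' => hr.1 ?_, fun h' => hr.2 ?_⟩⟩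
  · simp only [Prod.smul_fst, Prod.smul_snd, smul_eq_mul] at h'
    exact pos_of_mul_pos_right (a := c) (by linarith) hc.le
  · simp only [Prod.smul_fst, Prod.smul_snd, smul_eq_mul] at h'
    by_contra! hn
    have := mul_nonneg hc.le hn
    linarith

lemma eventually_pos_of_hasDerivAt {g : ℝ → ℝ} {g' : ℝ} (h : HasDerivAt g g' 0) (h0 : g 0 = 0)
    (hg' : 0 < g') : ∀ᶠ δ in 𝓝[>] (0 : ℝ), 0 < g δ := by
  have h1 := (hasDerivAt_iff_tendsto_slope.1 h).eventually (lt_mem_nhds hg')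
  have h2 : ∀ᶠ δ in 𝓝[>] (0 : ℝ), 0 < slope g 0 δ :=
    h1.filter_mono (nhdsWithin_mono _ fun x hx => ne_of_gt hx)
  filter_upwards [h2, self_mem_nhdsWithin] with δ hδ hpos
  rw [slope_def_field, h0, sub_zero, sub_zero] at hδ
  exact (div_pos_iff_of_pos_right hpos).1 hδ

lemma SplitsAt.movesInto {U V : Set (ℝ × ℝ)} {n : ℝ × ℝ} {θ : ℝ}
    (h : SplitsAt U V n (circlePt θ)) {d : ℝ × ℝ} {ω : ℝ}
    (hpos : 0 < n.1 * (d.1 - ω * sin θ) + n.2 * (d.2 + ω * cos θ)) : MovesInto U θ d ω := by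
  have hlin : HasDerivAt (fun δ : ℝ => θ + δ * ω) ω 0 := by
    simpa using ((hasDerivAt_id (0 : ℝ)).mul_const ω).const_add θ
  have hx : HasDerivAt (fun δ : ℝ => δ * d.1 + cos (θ + δ * ω) - cos θ)
      (d.1 - ω * sin θ) 0 := by
    have := (((hasDerivAt_id (0 : ℝ)).mul_const d.1).add hlin.cos).sub_const (cos θ)
    exact this.congr_deriv (by rw [zero_mul, add_zero]; ring)
  have hy : HasDerivAt (fun δ : ℝ => δ * d.2 + sin (θ + δ * ω) - sin θ)
      (d.2 + ω * cos θ) 0 := by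
    have := (((hasDerivAt_id (0 : ℝ)).mul_const d.2).add hlin.sin).sub_const (sin θ)
    exact this.congr_deriv (by rw [zero_mul, add_zero]; ring)
  have hev := eventually_pos_of_hasDerivAt ((hx.const_mul n.1).add (hy.const_mul n.2))
    (by simp) hpos
  filter_upwards [(tendsto_move θ d ω).eventually h.2, hev] with δ hδ hδ'
  exact hδ.1 (by simpa [circlePt] using hδ')

lemma movesInto_of_mem {U : Set (ℝ × ℝ)} (hU : IsOpen U) {θ : ℝ} (h : circlePt θ ∈ U)
    (d : ℝ × ℝ) (ω : ℝ) : MovesInto U θ d ω :=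
  (tendsto_move θ d ω).eventually (hU.mem_nhds h)

/-- No unit triangle with vertices at a point and at two points at angles `θ`, `θ + π / 3` from it
lies in `U`. -/
def NoTriangle (U : Set (ℝ × ℝ)) : Prop :=
  ∀ (q : ℝ × ℝ) (θ : ℝ), q ∈ U → q + circlePt θ ∈ U → q + circlePt (θ + π / 3) ∈ U → False

lemma NoTriangle.not_movesInto {U V : Set (ℝ × ℝ)} (h3 : NoTriangle U) {a : ℝ × ℝ}
    (hA : SplitsAt U V a 0) {θ : ℝ} {d : ℝ × ℝ} {ω : ℝ} (hd : 0 < a.1 * d.1 + a.2 * d.2)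
    (h1 : MovesInto U θ d ω) (h2 : MovesInto U (θ + π / 3) d ω) : False := by
  have ht : Tendsto (fun δ : ℝ => δ • d) (𝓝[>] 0) (𝓝 0) := by
    have h : Continuous (fun δ : ℝ => δ • d) := by fun_prop
    simpa using (h.tendsto 0).mono_left nhdsWithin_le_nhds
  obtain ⟨δ, ⟨⟨h0, h1⟩, h2⟩, hδ⟩ :=
    (((ht.eventually hA.2).and h1).and h2).and self_mem_nhdsWithin |>.exists
  refine h3 (δ • d) (θ + δ * ω) (h0.1 ?_) h1 (by convert h2 using 3; ring)
  have := mul_pos (Set.mem_Ioi.1 hδ) hd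
  simp only [Prod.smul_fst, Prod.smul_snd, smul_eq_mul, Prod.fst_zero, Prod.snd_zero, sub_zero]
  linarith

/-- The germ of the unit circle at angle `θ`, on the side given by the sign of `σ`, lies in `U`. -/
def GermIn (U : Set (ℝ × ℝ)) (σ θ : ℝ) : Prop := ∀ᶠ δ in 𝓝[>] (0 : ℝ), circlePt (θ + δ * σ) ∈ U

lemma movesInto_zero_iff {U : Set (ℝ × ℝ)} {θ σ : ℝ} : MovesInto U θ 0 σ ↔ GermIn U σ θ := by
  simp [MovesInto, GermIn]

lemma GermIn.not_disjoint {U V : Set (ℝ × ℝ)} (hd : Disjoint U V) {σ θ : ℝ}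
    (hU : GermIn U σ θ) (hV : GermIn V σ θ) : False := by
  obtain ⟨δ, h1, h2⟩ := (hU.and hV).exists
  exact Set.disjoint_left.1 hd h1 h2

lemma SplitsAt.germIn_of_pos {U V : Set (ℝ × ℝ)} {n : ℝ × ℝ} {θ : ℝ}
    (h : SplitsAt U V n (circlePt θ)) {σ : ℝ}
    (hpos : 0 < σ * (n.2 * cos θ - n.1 * sin θ)) : GermIn U σ θ :=
  movesInto_zero_iff.1 (h.movesInto (by simp; linarith))

/-- A circle tangent to the dividing line stays locally on the side of its centre. -/
lemma SplitsAt.germIn_of_tangent {U V : Set (ℝ × ℝ)} {c θ : ℝ}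
    (h : SplitsAt U V (c • circlePt θ) (circlePt θ)) (hc : 0 < c) {σ : ℝ} (hσ : σ ≠ 0) :
    GermIn V σ θ := by
  have ht := tendsto_move θ 0 σ
  simp only [smul_zero, zero_add] at ht
  have hlt : ∀ᶠ δ in 𝓝[>] (0 : ℝ), cos (δ * σ) < 1 := by
    have hcont : Tendsto (fun δ : ℝ => δ * σ) (𝓝[>] 0) (𝓝 0) := by
      have h : Continuous (fun δ : ℝ => δ * σ) := by fun_prop
      simpa using (h.tendsto 0).mono_left nhdsWithin_le_nhds
    have hI : Set.Ioo (-π) π ∈ 𝓝 (0 : ℝ) := Ioo_mem_nhds (by linarith [pi_pos]) pi_pos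
    filter_upwards [hcont.eventually hI, self_mem_nhdsWithin] with δ hδ hpos
    refine lt_of_le_of_ne (cos_le_one _) fun h1 => ?_
    have := (cos_eq_one_iff_of_lt_of_lt (by linarith [hδ.1, pi_pos]) (by linarith [hδ.2, pi_pos])).1
      h1
    exact (mul_ne_zero (ne_of_gt hpos) hσ) this
  filter_upwards [ht.eventually h.2, hlt] with δ hδ hδ'
  refine hδ.2 ?_
  simp only [circlePt, Prod.smul_fst, Prod.smul_snd, smul_eq_mul, cos_add, sin_add]
  have : c * cos θ * (cos θ * cos (δ * σ) - sin θ * sin (δ * σ) - cos θ) +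
      c * sin θ * (sin θ * cos (δ * σ) + cos θ * sin (δ * σ) - sin θ) = c * (cos (δ * σ) - 1) := by
    linear_combination c * (cos (δ * σ) - 1) * sin_sq_add_cos_sq θ
  rw [this]
  exact mul_neg_of_pos_of_neg hc (by linarith)

lemma eq_smul_circlePt {n : ℝ × ℝ} {θ : ℝ} (h : n.2 * cos θ - n.1 * sin θ = 0) :
    n = (n.1 * cos θ + n.2 * sin θ) • circlePt θ := by
  ext
  · simp only [circlePt, Prod.smul_fst, smul_eq_mul]
    linear_combination -sin θ * h - n.1 * sin_sq_add_cos_sq θ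
  · simp only [circlePt, Prod.smul_snd, smul_eq_mul]
    linear_combination cos θ * h - n.2 * sin_sq_add_cos_sq θ

/-- A tangential dividing line gives the same germ on both sides. -/
lemma SplitsAt.germIn_same {U V : Set (ℝ × ℝ)} {n : ℝ × ℝ} {θ : ℝ}
    (h : SplitsAt U V n (circlePt θ)) (h0 : n.2 * cos θ - n.1 * sin θ = 0) :
    (∀ σ : ℝ, σ ≠ 0 → GermIn U σ θ) ∨ (∀ σ : ℝ, σ ≠ 0 → GermIn V σ θ) := by
  have hn := eq_smul_circlePt h0
  set c := n.1 * cos θ + n.2 * sin θ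
  rcases lt_trichotomy c 0 with hc | hc | hc
  · left
    intro σ hσ
    have h' := h.symm
    rw [hn, ← neg_smul] at h'
    exact h'.germIn_of_tangent (by linarith) hσ
  · exact absurd (by rw [hn, hc, zero_smul]) h.1
  · right
    intro σ hσ
    rw [hn] at h
    exact h.germIn_of_tangent hc hσ

/-- A colour configuration around the centre `0`: the open sets `U` and `V` contain no unit
triangles, `0` lies on a dividing line with normal vector `a`, and so does every point of the unit
circle outside `U ∪ V`. -/
structure CircleConfig (U V : Set (ℝ × ℝ)) (a : ℝ × ℝ) : Prop where
  isOpen_left : IsOpen U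
  isOpen_right : IsOpen V
  disj : Disjoint U V
  noTriangle_left : NoTriangle U
  noTriangle_right : NoTriangle V
  center : SplitsAt U V a 0
  circle : ∀ θ, circlePt θ ∈ U ∨ circlePt θ ∈ V ∨ ∃ n, SplitsAt U V n (circlePt θ)

namespace CircleConfig

variable {U V : Set (ℝ × ℝ)} {a : ℝ × ℝ}

lemma symm (h : CircleConfig U V a) : CircleConfig V U (-a) where
  isOpen_left := h.isOpen_right
  isOpen_right := h.isOpen_left
  disj := h.disj.symm
  noTriangle_left := h.noTriangle_right
  noTriangle_right := h.noTriangle_left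
  center := h.center.symm
  circle θ := by
    rcases h.circle θ with h | h | ⟨n, h⟩
    · exact Or.inr (Or.inl h)
    · exact Or.inl h
    · exact Or.inr (Or.inr ⟨-n, h.symm⟩)

lemma germIn_or (h : CircleConfig U V a) (θ : ℝ) {σ : ℝ} (hσ : σ ≠ 0) :
    GermIn U σ θ ∨ GermIn V σ θ := by
  rcases h.circle θ with hU | hV | ⟨n, hn⟩
  · exact Or.inl (movesInto_zero_iff.1 (movesInto_of_mem h.isOpen_left hU 0 σ))
  · exact Or.inr (movesInto_zero_iff.1 (movesInto_of_mem h.isOpen_right hV 0 σ))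
  · rcases lt_trichotomy (σ * (n.2 * cos θ - n.1 * sin θ)) 0 with h0 | h0 | h0
    · refine Or.inr (hn.symm.germIn_of_pos ?_)
      simp only [Prod.fst_neg, Prod.snd_neg]
      linarith
    · rcases hn.germIn_same ((mul_eq_zero.1 h0).resolve_left hσ) with h | h
      · exact Or.inl (h σ hσ)
      · exact Or.inr (h σ hσ)
    · exact Or.inl (hn.germIn_of_pos h0)

lemma not_both_mem (h : CircleConfig U V a) {θ : ℝ} (h1 : circlePt θ ∈ U)
    (h2 : circlePt (θ + π / 3) ∈ U) : False := by
  exact h.noTriangle_left.not_movesInto h.center (d := a) (ω := 0) h.center.normal_pos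
    (movesInto_of_mem h.isOpen_left h1 _ _) (movesInto_of_mem h.isOpen_left h2 _ _)

lemma germIn_rotate (h : CircleConfig U V a) {σ θ : ℝ} (hσ : σ ≠ 0) (hg : GermIn U σ θ) :
    GermIn V σ (θ + π / 3) := by
  refine (h.germIn_or (θ + π / 3) hσ).resolve_left fun hg' => ?_
  obtain ⟨δ, h1, h2⟩ := (hg.and hg').exists
  exact h.not_both_mem h1 (by convert h2 using 2; ring)

/-- Where the circle passes from `U` to `V` there is a transversal dividing line, whose normal
vector can be normalised. -/
lemma exists_normal (h : CircleConfig U V a) {θ : ℝ} (h1 : GermIn U (-1) θ) (h2 : GermIn V 1 θ) :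
    ∃ m : ℝ × ℝ, SplitsAt U V m (circlePt θ) ∧ m.2 * cos θ - m.1 * sin θ = -1 := by
  rcases h.circle θ with hU | hV | ⟨n, hn⟩
  · exact (GermIn.not_disjoint h.disj
      (movesInto_zero_iff.1 (movesInto_of_mem h.isOpen_left hU 0 1)) h2).elim
  · exact (GermIn.not_disjoint h.disj h1
      (movesInto_zero_iff.1 (movesInto_of_mem h.isOpen_right hV 0 (-1)))).elim
  · rcases lt_trichotomy (n.2 * cos θ - n.1 * sin θ) 0 with h0 | h0 | h0
    · refine ⟨(-(n.2 * cos θ - n.1 * sin θ))⁻¹ • n, hn.smul (inv_pos.2 (neg_pos.2 h0)), ?_⟩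
      simp only [Prod.smul_fst, Prod.smul_snd, smul_eq_mul]
      linear_combination -inv_mul_cancel₀ (neg_pos.2 h0).ne'
    · rcases hn.germIn_same h0 with hg | hg
      · exact (GermIn.not_disjoint h.disj (hg 1 one_ne_zero) h2).elim
      · exact (GermIn.not_disjoint h.disj h1 (hg (-1) (by norm_num))).elim
    · exact (GermIn.not_disjoint h.disj (hn.germIn_of_pos (by linarith)) h2).elim

lemma exists_normal' (h : CircleConfig U V a) {θ : ℝ} (h1 : GermIn V (-1) θ) (h2 : GermIn U 1 θ) :
    ∃ m : ℝ × ℝ, SplitsAt U V m (circlePt θ) ∧ m.2 * cos θ - m.1 * sin θ = 1 := by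
  obtain ⟨m, hm, hm'⟩ := h.symm.exists_normal h1 h2
  refine ⟨-m, hm.symm, ?_⟩
  simp only [Prod.fst_neg, Prod.snd_neg]
  linarith

/-- Balance condition for the normal vectors at two points of the circle that form a unit triangle
with the centre. -/
lemma balance (h : CircleConfig U V a) {c : ℝ} (hc : 0 < c) (ha : a = (c, 0)) {θ s : ℝ}
    (hs : s * s = 1) {m m' : ℝ × ℝ} (hm : SplitsAt U V m (circlePt θ))
    (hm' : SplitsAt U V m' (circlePt (θ + π / 3))) (ht : m.2 * cos θ - m.1 * sin θ = -s)
    (ht' : m'.2 * cos (θ + π / 3) - m'.1 * sin (θ + π / 3) = s) :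
    m.2 + m'.2 = 0 ∧ m.1 + m'.1 ≤ 0 := by
  have key : ∀ y : ℝ, m.1 + m'.1 + (m.2 + m'.2) * y ≤ 0 := by
    intro y
    by_contra! hy
    let ω : ℝ := s * ((m.1 + m.2 * y) - (m'.1 + m'.2 * y)) / 2
    have hω : s * ω = ((m.1 + m.2 * y) - (m'.1 + m'.2 * y)) / 2 := by
      simp only [ω]
      linear_combination ((m.1 + m.2 * y) - (m'.1 + m'.2 * y)) / 2 * hs
    refine h.noTriangle_left.not_movesInto h.center (d := (1, y)) (ω := ω) (θ := θ)
      (by simpa [ha] using hc) (hm.movesInto ?_) (hm'.movesInto ?_)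
    · have : m.1 * (1 - ω * sin θ) + m.2 * (y + ω * cos θ) = m.1 + m.2 * y - s * ω := by
        linear_combination ω * ht
      simp only [this, hω]
      linarith
    · have : m'.1 * (1 - ω * sin (θ + π / 3)) + m'.2 * (y + ω * cos (θ + π / 3)) =
          m'.1 + m'.2 * y + s * ω := by
        linear_combination ω * ht'
      simp only [this, hω]
      linarith
  have hx := key 0
  have hy : m.2 + m'.2 = 0 := by
    by_contra hne
    have := key ((1 - (m.1 + m'.1)) / (m.2 + m'.2))
    rw [mul_div_cancel₀ _ hne] at this
    linarith
  exact ⟨hy, by linarith⟩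

/-- On the sixth of the circle starting at the normal direction of the centre, the circle cannot
pass from `U` to `V`. -/
lemma not_crossing (h : CircleConfig U V a) {c : ℝ} (hc : 0 < c) (ha : a = (c, 0)) {θ : ℝ}
    (h0 : 0 < θ) (h3 : θ < π / 3) (hl : GermIn U (-1) θ) (hr : GermIn V 1 θ) : False := by
  have n1 : (-1 : ℝ) ≠ 0 := by norm_num
  have p1 : (1 : ℝ) ≠ 0 := one_ne_zero
  have hl1 := h.germIn_rotate n1 hl
  have hr1 := h.symm.germIn_rotate p1 hr
  have hl2 := h.symm.germIn_rotate n1 hl1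
  have hr2 := h.germIn_rotate p1 hr1
  have hl3 := h.germIn_rotate n1 hl2
  have hr3 := h.symm.germIn_rotate p1 hr2
  have hl4 := h.symm.germIn_rotate n1 hl3
  have hr4 := h.germIn_rotate p1 hr3
  have hl5 := h.germIn_rotate n1 hl4
  have hr5 := h.symm.germIn_rotate p1 hr4
  obtain ⟨m0, hm0, e0⟩ := h.exists_normal hl hr
  obtain ⟨m1, hm1, e1⟩ := h.exists_normal' hl1 hr1
  obtain ⟨m2, hm2, e2⟩ := h.exists_normal hl2 hr2
  obtain ⟨m3, hm3, e3⟩ := h.exists_normal' hl3 hr3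
  obtain ⟨m4, hm4, e4⟩ := h.exists_normal hl4 hr4
  obtain ⟨m5, hm5, e5⟩ := h.exists_normal' hl5 hr5
  obtain ⟨y01, x01⟩ := h.balance hc ha (s := 1) (by norm_num) hm0 hm1 e0 e1
  obtain ⟨y12, -⟩ := h.balance hc ha (s := -1) (by norm_num) hm1 hm2 (by linarith) e2
  obtain ⟨y23, x23⟩ := h.balance hc ha (s := 1) (by norm_num) hm2 hm3 e2 e3
  obtain ⟨y34, -⟩ := h.balance hc ha (s := -1) (by norm_num) hm3 hm4 (by linarith) e4
  obtain ⟨y45, x45⟩ := h.balance hc ha (s := 1) (by norm_num) hm4 hm5 e4 e5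
  have hs0 : 0 < sin θ := sin_pos_of_pos_of_lt_pi h0 (by linarith [pi_pos])
  have hs1 : 0 < sin (θ + π / 3) := sin_pos_of_pos_of_lt_pi (by linarith) (by linarith [pi_pos])
  have hs2 : 0 < sin (θ + π / 3 + π / 3) :=
    sin_pos_of_pos_of_lt_pi (by linarith [pi_pos]) (by linarith [pi_pos])
  have hsum : sin (θ + π / 3) = sin θ + sin (θ + π / 3 + π / 3) := by
    rw [sin_add (θ + π / 3), sin_add θ, cos_add θ, sin_pi_div_three, cos_pi_div_three]
    linear_combination (sin θ / 4) * sq_sqrt (show (0 : ℝ) ≤ 3 by norm_num)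
  have a3 : ∀ x : ℝ, x + π / 3 + π / 3 + π / 3 = x + π := fun x => by ring
  rw [a3 θ, cos_add_pi, sin_add_pi] at e3
  rw [a3 (θ + π / 3), cos_add_pi, sin_add_pi] at e4
  rw [a3 (θ + π / 3 + π / 3), cos_add_pi, sin_add_pi] at e5
  have f0 : (m0.1 + m3.1) * sin θ = 2 := by
    linear_combination e3 - e0 + cos θ * (y01 - y12 + y23)
  have f1 : (m1.1 + m4.1) * sin (θ + π / 3) = -2 := by
    linear_combination e4 - e1 + cos (θ + π / 3) * (y12 - y23 + y34)
  have f2 : (m2.1 + m5.1) * sin (θ + π / 3 + π / 3) = 2 := by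
    linear_combination e5 - e2 + cos (θ + π / 3 + π / 3) * (y23 - y34 + y45)
  have g0 : m0.1 + m3.1 = 2 / sin θ := by rw [eq_div_iff hs0.ne']; exact f0
  have g1 : m1.1 + m4.1 = -(2 / sin (θ + π / 3)) := by
    rw [← neg_div, eq_div_iff hs1.ne']; exact f1
  have g2 : m2.1 + m5.1 = 2 / sin (θ + π / 3 + π / 3) := by rw [eq_div_iff hs2.ne']; exact f2
  have hlt : 2 / sin (θ + π / 3) < 2 / sin θ :=
    div_lt_div_of_pos_left two_pos hs0 (by linarith)
  have hp : 0 < 2 / sin (θ + π / 3 + π / 3) := by positivity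
  linarith

/-- If `circlePt 0` lies on a dividing line, then `circlePt (π / 3)` is not in `V`. -/
lemma rotate_notMem_right (h : CircleConfig U V a) {n : ℝ × ℝ} (hn : SplitsAt U V n (circlePt 0)) :
    circlePt (π / 3) ∉ V := by
  intro hQ
  have hQ' : circlePt (0 + π / 3) ∈ V := by rwa [zero_add]
  have hfirst : ∀ (d : ℝ × ℝ) (ω : ℝ), a.1 * d.1 + a.2 * d.2 < 0 →
      0 ≤ n.1 * d.1 + n.2 * (d.2 + ω) := by
    intro d ω hd
    by_contra! hlt
    refine h.noTriangle_right.not_movesInto h.center.symm (d := d) (ω := ω) (θ := 0)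
      (by simp; linarith) (hn.symm.movesInto ?_) (movesInto_of_mem h.isOpen_right hQ' _ _)
    simp
    linarith
  have hapos := h.center.normal_pos
  have hn2 : n.2 = 0 := by
    by_contra hne
    have := hfirst (-a) ((-1 + n.1 * a.1 + n.2 * a.2) / n.2) (by simp; linarith)
    rw [mul_add, mul_div_cancel₀ _ hne] at this
    simp at this
    linarith
  have hn1 : n.1 ≠ 0 := fun h1 => hn.1 (Prod.ext h1 hn2)
  have hna : ∀ d : ℝ × ℝ, a.1 * d.1 + a.2 * d.2 < 0 → 0 ≤ n.1 * d.1 := by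
    intro d hd
    simpa [hn2] using hfirst d 0 hd
  have ha2 : a.2 = 0 := by
    by_contra hne
    have := hna (-n.1, (-1 + a.1 * n.1) / a.2) (by
      simp only [mul_div_cancel₀ _ hne]; linarith)
    simp only at this
    nlinarith [mul_self_pos.2 hn1]
  have hnlt : n.1 < 0 := by
    rcases lt_or_gt_of_ne hn1 with h' | h'
    · exact h'
    · exfalso
      have hg : GermIn V 1 0 := by
        have : n = n.1 • circlePt 0 := by ext <;> simp [circlePt, hn2]
        rw [this] at hn
        exact hn.germIn_of_tangent h' one_ne_zero
      have hg' := h.symm.germIn_rotate one_ne_zero hg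
      exact GermIn.not_disjoint h.disj hg'
        (movesInto_zero_iff.1 (movesInto_of_mem h.isOpen_right hQ' 0 1))
  have ha1 : 0 < a.1 := by
    have := hna (-a.1, 0) (by simp; nlinarith)
    simp only at this
    have hne : a.1 ≠ 0 := fun h1 => by simp [h1, ha2] at hapos
    rcases lt_or_gt_of_ne hne with h' | h'
    · nlinarith
    · exact h'
  have haeq : a = (a.1, 0) := Prod.ext rfl ha2
  have hg0 : GermIn U 1 0 := by
    have : -n = (-n.1) • circlePt 0 := by ext <;> simp [circlePt, hn2]
    have h' := hn.symm
    rw [this] at h'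
    exact h'.germIn_of_tangent (by linarith) one_ne_zero
  have germ_right : ∀ {W : Set (ℝ × ℝ)} {θ : ℝ}, GermIn W 1 θ →
      ∃ ε > 0, ∀ t, θ < t → t < θ + ε → circlePt t ∈ W := by
    intro W θ hg
    obtain ⟨ε, hε, hsub⟩ := mem_nhdsGT_iff_exists_Ioo_subset.1 hg
    refine ⟨ε, hε, fun t h1 h2 => ?_⟩
    have := hsub (show t - θ ∈ Set.Ioo 0 ε from ⟨by linarith, by linarith⟩)
    simpa using this
  have germ_left : ∀ {W : Set (ℝ × ℝ)} {θ : ℝ}, GermIn W (-1) θ →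
      ∃ ε > 0, ∀ t, θ - ε < t → t < θ → circlePt t ∈ W := by
    intro W θ hg
    obtain ⟨ε, hε, hsub⟩ := mem_nhdsGT_iff_exists_Ioo_subset.1 hg
    refine ⟨ε, hε, fun t h1 h2 => ?_⟩
    have := hsub (show θ - t ∈ Set.Ioo 0 ε from ⟨by linarith, by linarith⟩)
    simpa using this
  have memV_left : ∀ {θ : ℝ}, circlePt θ ∈ V → ∃ ε > 0, ∀ t, θ - ε < t → t < θ → circlePt t ∈ V :=
    fun hθ => germ_left (movesInto_zero_iff.1 (movesInto_of_mem h.isOpen_right hθ 0 (-1)))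
  let T : Set ℝ := {t | 0 < t ∧ t < π / 3 ∧ circlePt t ∈ V}
  have hTb : BddBelow T := ⟨0, fun t ht => ht.1.le⟩
  obtain ⟨ε, hε, hU0⟩ := germ_right hg0
  obtain ⟨η, hη, hV3⟩ := memV_left hQ
  have hTne : ∃ t ∈ T, t < π / 3 := by
    have hpi := pi_pos
    obtain ⟨t, h1, h2⟩ := exists_between (show max 0 (π / 3 - η) < π / 3 by
      apply max_lt <;> linarith)
    exact ⟨t, ⟨(le_max_left _ _).trans_lt h1, h2, hV3 t ((le_max_right _ _).trans_lt h1) h2⟩, h2⟩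
  obtain ⟨t₀, ht₀, ht₀'⟩ := hTne
  set θ := sInf T
  have hθε : ε ≤ θ := le_csInf ⟨t₀, ht₀⟩ fun t ht => by
    by_contra! hlt
    exact Set.disjoint_left.1 h.disj (hU0 t ht.1 (by linarith)) ht.2.2
  have hθ3 : θ < π / 3 := (csInf_le hTb ht₀).trans_lt ht₀'
  have hθ0 : 0 < θ := hε.trans_le hθε
  have hbelow : ∀ t, 0 < t → t < θ → circlePt t ∉ V := fun t h1 h2 hV =>
    (csInf_le hTb (show t ∈ T from ⟨h1, h2.trans hθ3, hV⟩)).not_gt h2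
  have hnotl : ∀ ε' > 0, (∀ t, θ - ε' < t → t < θ → circlePt t ∈ V) → False := by
    intro ε' hε' hall
    obtain ⟨t, h1, h2⟩ := exists_between (show max 0 (θ - ε') < θ by apply max_lt <;> linarith)
    exact hbelow t ((le_max_left _ _).trans_lt h1) h2 (hall t ((le_max_right _ _).trans_lt h1) h2)
  have hleft : GermIn U (-1) θ := by
    refine (h.germIn_or θ (by norm_num)).resolve_right fun hg => ?_
    obtain ⟨ε', hε', hall⟩ := germ_left hg
    exact hnotl ε' hε' hall
  have hright : GermIn V 1 θ := by
    refine (h.germIn_or θ one_ne_zero).resolve_left fun hg => ?_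
    obtain ⟨ε', hε', hall⟩ := germ_right hg
    obtain ⟨t, ht, htlt⟩ := exists_lt_of_csInf_lt ⟨t₀, ht₀⟩ (show sInf T < θ + ε' by
      change θ < θ + ε'; linarith)
    rcases (csInf_le hTb ht).lt_or_eq with hlt | heq
    · exact Set.disjoint_left.1 h.disj (hall t hlt htlt) ht.2.2
    · have hV : circlePt θ ∈ V := by rw [show θ = t from heq]; exact ht.2.2
      obtain ⟨ε'', hε'', hall'⟩ := memV_left hV
      exact hnotl ε'' hε'' hall'
  exact h.not_crossing ha1 haeq hθ0 hθ3 hleft hright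

lemma rotate_notMem (h : CircleConfig U V a) {n : ℝ × ℝ} (hn : SplitsAt U V n (circlePt 0)) :
    circlePt (π / 3) ∉ U ∧ circlePt (π / 3) ∉ V :=
  ⟨h.symm.rotate_notMem_right hn.symm, h.rotate_notMem_right hn⟩

end CircleConfig

namespace IsPolygonal

variable {B : Set (EuclideanSpace ℝ (Fin 2))} {S : Set (Set (EuclideanSpace ℝ (Fin 2)))}
  {P : EuclideanSpace ℝ (Fin 2)}

/-- Near a boundary point that is not a vertex, the boundary is contained in a line. -/
lemma exists_normal_frontier (h : IsPolygonal B S) (hP : P ∈ frontier B) (hv : ¬IsVertex S P) :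
    ∃ n : EuclideanSpace ℝ (Fin 2), n ≠ 0 ∧
      ∀ᶠ X in 𝓝 P, X ∈ frontier B → ⟪n, X - P⟫ = 0 := by
  rw [h.boundary] at hP
  obtain ⟨s, hs, hPs⟩ := hP
  obtain ⟨-, -, -, l, ⟨-, hl⟩, hsl⟩ := h.seg s hs
  have hne : l.directionᗮ ≠ ⊥ := by
    rw [Ne, Submodule.orthogonal_eq_bot_iff]
    intro htop
    rw [htop, finrank_top, finrank_euclideanSpace_fin] at hl
    norm_num at hl
  obtain ⟨n, hn, hn0⟩ := Submodule.exists_mem_ne_zero_of_ne_bot hne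
  refine ⟨n, hn0, ?_⟩
  have hfin : ({t ∈ S | (t ∩ Metric.ball P 1).Nonempty} \ {s}).Finite :=
    (h.loc_finite _ Metric.isBounded_ball).sdiff
  have hcl : IsClosed (⋃ t ∈ {t ∈ S | (t ∩ Metric.ball P 1).Nonempty} \ {s}, t) :=
    hfin.isClosed_biUnion fun t ht => (h.seg t ht.1.1).1
  have hnot : P ∉ ⋃ t ∈ {t ∈ S | (t ∩ Metric.ball P 1).Nonempty} \ {s}, t := by
    simp only [Set.mem_iUnion, not_exists]
    intro t ht hPt
    exact hv ⟨t, ht.1.1, (h.inter_endpoint t ht.1.1 s hs ht.2 P ⟨hPt, hPs⟩).1⟩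
  filter_upwards [hcl.isOpen_compl.mem_nhds hnot, Metric.ball_mem_nhds P one_pos] with X hX hXb hXf
  rw [h.boundary] at hXf
  obtain ⟨t, ht, hXt⟩ := hXf
  have hts : t = s := by
    by_contra hne
    exact hX (Set.mem_biUnion (show t ∈ _ from ⟨⟨ht, X, hXt, hXb⟩, hne⟩) hXt)
  subst hts
  rw [real_inner_comm]
  exact (Submodule.mem_orthogonal _ _).1 hn _
    (AffineSubspace.vsub_mem_direction (hsl hXt) (hsl hPs))

lemma mem_interior_or {X : EuclideanSpace ℝ (Fin 2)} (hX : X ∉ frontier B) :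
    X ∈ interior B ∨ X ∈ interior Bᶜ := by
  by_contra! hn
  rw [interior_compl] at hn
  exact hX ⟨not_not.1 hn.2, hn.1⟩

lemma subset_interior_or {C : Set (EuclideanSpace ℝ (Fin 2))} (hC : Convex ℝ C)
    (hd : ∀ X ∈ C, X ∉ frontier B) : C ⊆ interior B ∨ C ⊆ interior Bᶜ :=
  hC.isPreconnected.subset_or_subset isOpen_interior isOpen_interior
    (Disjoint.mono interior_subset interior_subset disjoint_compl_right)
    fun X hX => mem_interior_or (hd X hX)

/-- A nonempty open set is not contained in a line. -/
lemma exists_inner_ne_zero {O : Set (EuclideanSpace ℝ (Fin 2))} (hO : IsOpen O)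
    (hne : O.Nonempty) {n : EuclideanSpace ℝ (Fin 2)} (hn : n ≠ 0) :
    ∃ X ∈ O, ⟪n, X - P⟫ ≠ 0 := by
  obtain ⟨Y, hY⟩ := hne
  by_cases h0 : ⟪n, Y - P⟫ = 0
  · have hc : Continuous fun δ : ℝ => Y + δ • n := by fun_prop
    have ht : Tendsto (fun δ : ℝ => Y + δ • n) (𝓝[>] 0) (𝓝 Y) := by
      simpa using (hc.tendsto 0).mono_left nhdsWithin_le_nhds
    obtain ⟨δ, hδ, hpos⟩ := ((ht.eventually (hO.mem_nhds hY)).and self_mem_nhdsWithin).exists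
    refine ⟨_, hδ, ?_⟩
    rw [add_sub_right_comm, inner_add_right, h0, zero_add, inner_smul_right]
    exact mul_ne_zero (ne_of_gt hpos) (inner_self_ne_zero.2 hn)
  · exact ⟨Y, hY, h0⟩

/-- Near a boundary point that is not a vertex, the two sides of a line are coloured
differently. -/
lemma exists_split (h : IsPolygonal B S) (hP : P ∈ frontier B) (hv : ¬IsVertex S P) :
    ∃ n : EuclideanSpace ℝ (Fin 2), n ≠ 0 ∧
      ∀ᶠ X in 𝓝 P, (0 < ⟪n, X - P⟫ → X ∈ interior B) ∧
        (⟪n, X - P⟫ < 0 → X ∈ interior Bᶜ) := by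
  obtain ⟨n, hn, hev⟩ := h.exists_normal_frontier hP hv
  obtain ⟨ε, hε, hball⟩ := Metric.eventually_nhds_iff_ball.1 hev
  have hlin : IsLinearMap ℝ fun X => ⟪n, X⟫ :=
    ⟨fun x y => inner_add_right _ _ _, fun c x => inner_smul_right _ _ _⟩
  have hpos := subset_interior_or (B := B)
    (C := Metric.ball P ε ∩ {X | ⟪n, P⟫ < ⟪n, X⟫})
    ((convex_ball P ε).inter (convex_halfSpace_gt hlin _)) fun X hX hXf => by
      have h0 := hball X hX.1 hXf
      rw [inner_sub_right] at h0
      exact (sub_pos.2 hX.2).ne' h0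
  have hneg := subset_interior_or (B := B)
    (C := Metric.ball P ε ∩ {X | ⟪n, X⟫ < ⟪n, P⟫})
    ((convex_ball P ε).inter (convex_halfSpace_lt hlin _)) fun X hX hXf => by
      have h0 := hball X hX.1 hXf
      rw [inner_sub_right] at h0
      exact (sub_neg.2 hX.2).ne h0
  have honly : ∀ D : Set (EuclideanSpace ℝ (Fin 2)), Dᶜ ⊆ closure (interior Dᶜ) →
      P ∈ frontier D → Metric.ball P ε ∩ {X | ⟪n, P⟫ < ⟪n, X⟫} ⊆ interior D →
      Metric.ball P ε ∩ {X | ⟪n, X⟫ < ⟪n, P⟫} ⊆ interior D → False := by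
    intro D hD hPD h1 h2
    have hPc : P ∈ closure (interior Dᶜ) :=
      closure_minimal hD isClosed_closure (frontier_subset_closure (frontier_compl D ▸ hPD))
    obtain ⟨X, ⟨hXb, hXD⟩, hX⟩ := exists_inner_ne_zero (P := P)
      (Metric.isOpen_ball.inter isOpen_interior)
      (mem_closure_iff.1 hPc _ Metric.isOpen_ball (Metric.mem_ball_self hε)) hn
    have hXD' := interior_subset hXD
    rw [inner_sub_right] at hX
    rcases lt_or_gt_of_ne hX with hX | hX
    · exact hXD' (interior_subset (h2 ⟨hXb, sub_neg.1 hX⟩))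
    · exact hXD' (interior_subset (h1 ⟨hXb, sub_pos.1 hX⟩))
  rcases hpos with hpos | hpos <;> rcases hneg with hneg | hneg
  · exact (honly B h.white_sub hP hpos hneg).elim
  · refine ⟨n, hn, Metric.eventually_nhds_iff_ball.2 ⟨ε, hε, fun X hX => ⟨fun h' => ?_,
      fun h' => ?_⟩⟩⟩ <;> rw [inner_sub_right] at h'
    · exact hpos ⟨hX, sub_pos.1 h'⟩
    · exact hneg ⟨hX, sub_neg.1 h'⟩
  · refine ⟨-n, neg_ne_zero.2 hn, Metric.eventually_nhds_iff_ball.2 ⟨ε, hε, fun X hX =>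
      ⟨fun h' => ?_, fun h' => ?_⟩⟩⟩ <;> rw [inner_neg_left, inner_sub_right] at h'
    · exact hneg ⟨hX, by simp only [Set.mem_ofPred_eq]; linarith⟩
    · exact hpos ⟨hX, by simp only [Set.mem_ofPred_eq]; linarith⟩
  · exact (honly Bᶜ (by simpa using h.black_sub) (by rwa [frontier_compl]) hpos hneg).elim

end IsPolygonal

/-- The isometric coordinates of the plane with origin `A` and first basis vector `u`. -/
def frame (A u : EuclideanSpace ℝ (Fin 2)) (r : ℝ × ℝ) : EuclideanSpace ℝ (Fin 2) :=
  A + !₂[r.1 * u 0 - r.2 * u 1, r.1 * u 1 + r.2 * u 0]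

lemma continuous_frame (A u : EuclideanSpace ℝ (Fin 2)) : Continuous (frame A u) := by
  unfold frame
  refine continuous_const.add ((PiLp.continuous_toLp 2 _).comp (continuous_pi fun i => ?_))
  fin_cases i <;> simp <;> fun_prop

lemma dist_frame {A u : EuclideanSpace ℝ (Fin 2)} (hu : u 0 ^ 2 + u 1 ^ 2 = 1) (r r' : ℝ × ℝ) :
    dist (frame A u r) (frame A u r') = √((r.1 - r'.1) ^ 2 + (r.2 - r'.2) ^ 2) := by
  rw [EuclideanSpace.dist_eq]
  congr 1
  simp only [frame, Fin.sum_univ_two, PiLp.add_apply, Real.dist_eq, sq_abs]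
  simp
  linear_combination ((r.1 - r'.1) ^ 2 + (r.2 - r'.2) ^ 2) * hu

lemma C3.noTriangle {B D : Set (EuclideanSpace ℝ (Fin 2))} (h : C3 B) (hD : D = B ∨ D = Bᶜ)
    {A u : EuclideanSpace ℝ (Fin 2)} (hu : u 0 ^ 2 + u 1 ^ 2 = 1) :
    NoTriangle (frame A u ⁻¹' interior D) := by
  intro q θ h1 h2 h3
  have hf : ∀ X ∈ interior D, X ∉ frontier B := by
    intro X hX hXf
    have : X ∈ frontier D := by
      rcases hD with rfl | rfl
      · exact hXf
      · rwa [frontier_compl]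
    exact this.2 hX
  have hsc := sin_sq_add_cos_sq θ
  have hsc' := sin_sq_add_cos_sq (θ + π / 3)
  have hcos : cos θ * cos (θ + π / 3) + sin θ * sin (θ + π / 3) = 1 / 2 := by
    rw [← cos_sub, ← cos_pi_div_three, ← cos_neg]
    congr 1
    ring
  have hmem := interior_subset h1
  have hmem' := interior_subset h2
  have hmem'' := interior_subset h3
  have := h (frame A u q) (frame A u (q + circlePt θ)) (frame A u (q + circlePt (θ + π / 3)))
    (by
      rw [dist_frame hu, Real.sqrt_eq_one]
      simp only [circlePt, Prod.fst_add, Prod.snd_add]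
      linear_combination hsc)
    (by
      rw [dist_frame hu, Real.sqrt_eq_one]
      simp only [circlePt, Prod.fst_add, Prod.snd_add]
      linear_combination hsc + hsc' - 2 * hcos)
    (by
      rw [dist_frame hu, Real.sqrt_eq_one]
      simp only [circlePt, Prod.fst_add, Prod.snd_add]
      linear_combination hsc')
    (by rcases hD with rfl | rfl <;> tauto)
  rcases this with h' | h' | h'
  · exact hf _ h1 h'
  · exact hf _ h2 h'
  · exact hf _ h3 h'

lemma IsPolygonal.splitsAt {B : Set (EuclideanSpace ℝ (Fin 2))}
    {S : Set (Set (EuclideanSpace ℝ (Fin 2)))} (h : IsPolygonal B S)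
    {A u : EuclideanSpace ℝ (Fin 2)} (hu : u 0 ^ 2 + u 1 ^ 2 = 1) {q : ℝ × ℝ}
    (hq : frame A u q ∈ frontier B) (hv : ¬IsVertex S (frame A u q)) :
    ∃ n, SplitsAt (frame A u ⁻¹' interior B) (frame A u ⁻¹' interior Bᶜ) n q := by
  obtain ⟨n, hn, hev⟩ := h.exists_split hq hv
  refine ⟨(n 0 * u 0 + n 1 * u 1, n 1 * u 0 - n 0 * u 1), fun h0 => hn ?_, ?_⟩
  · obtain ⟨h1, h2⟩ := Prod.mk.inj h0
    ext i
    fin_cases i <;> simp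
    · linear_combination u 0 * h1 - u 1 * h2 - n 0 * hu
    · linear_combination u 1 * h1 + u 0 * h2 - n 1 * hu
  · filter_upwards [(continuous_frame A u).continuousAt.eventually hev] with r hr
    have : ⟪n, frame A u r - frame A u q⟫ = (n 0 * u 0 + n 1 * u 1) * (r.1 - q.1) +
        (n 1 * u 0 - n 0 * u 1) * (r.2 - q.2) := by
      simp only [frame, PiLp.inner_apply, Fin.sum_univ_two]
      simp
      ring
    rwa [this] at hr

/-- Rotating a boundary point of the unit circle of a feasible point by `π / 3` gives a boundary
point. -/
lemma Feasible.rotate_mem_frontier {B : Set (EuclideanSpace ℝ (Fin 2))}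
    {S : Set (Set (EuclideanSpace ℝ (Fin 2)))} (hpoly : IsPolygonal B S) (hC3 : C3 B)
    {A P : EuclideanSpace ℝ (Fin 2)} (hA : Feasible B S A) (hAP : dist A P = 1)
    (hP : P ∈ frontier B) : A + rotVec (π / 3) (P - A) ∈ frontier B := by
  obtain ⟨hAf, hAv, hsphere⟩ := hA
  set u := P - A with hudef
  have hu : u 0 ^ 2 + u 1 ^ 2 = 1 := by
    have : ‖u‖ ^ 2 = 1 := by rw [hudef, ← dist_eq_norm, dist_comm, hAP, one_pow]
    rw [EuclideanSpace.norm_sq_eq, Fin.sum_univ_two] at this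
    simpa using this
  have hframe0 : frame A u 0 = A := by
    ext i
    fin_cases i <;> simp [frame]
  have hframe1 : frame A u (circlePt 0) = P := by
    ext i
    fin_cases i <;> simp [frame, circlePt, hudef]
  have hframe2 : frame A u (circlePt (π / 3)) = A + rotVec (π / 3) u := by
    ext i
    fin_cases i <;> simp [frame, circlePt, rotVec]
    ring
  have hvert : ∀ θ, ¬IsVertex S (frame A u (circlePt θ)) := by
    refine fun θ => hsphere _ ?_
    rw [Metric.mem_sphere]
    nth_rw 2 [← hframe0]
    rw [dist_frame hu, Real.sqrt_eq_one]
    simp [circlePt]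
  obtain ⟨a, ha⟩ := hpoly.splitsAt hu (q := 0) (by rwa [hframe0]) (by rwa [hframe0])
  have hconf : CircleConfig (frame A u ⁻¹' interior B) (frame A u ⁻¹' interior Bᶜ) a :=
    { isOpen_left := isOpen_interior.preimage (continuous_frame A u)
      isOpen_right := isOpen_interior.preimage (continuous_frame A u)
      disj := (Disjoint.mono interior_subset interior_subset disjoint_compl_right).preimage _
      noTriangle_left := hC3.noTriangle (Or.inl rfl) hu
      noTriangle_right := hC3.noTriangle (Or.inr rfl) hu
      center := ha
      circle := fun θ => by
        by_cases hθ : frame A u (circlePt θ) ∈ frontier B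
        · exact Or.inr (Or.inr (hpoly.splitsAt hu hθ (hvert θ)))
        · exact (IsPolygonal.mem_interior_or hθ).imp_right Or.inl }
  obtain ⟨n, hn⟩ := hpoly.splitsAt hu (q := circlePt 0) (by rwa [hframe1]) (hvert 0)
  obtain ⟨h1, h2⟩ := hconf.rotate_notMem hn
  by_contra hQ
  rw [← hframe2] at hQ
  exact (IsPolygonal.mem_interior_or hQ).elim h1 h2

lemma rotVec_add (α β : ℝ) (v : EuclideanSpace ℝ (Fin 2)) :
    rotVec α (rotVec β v) = rotVec (α + β) v := by
  ext i
  fin_cases i <;> simp [rotVec, cos_add, sin_add] <;> ring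

lemma norm_rotVec (α : ℝ) (v : EuclideanSpace ℝ (Fin 2)) : ‖rotVec α v‖ = ‖v‖ := by
  rw [EuclideanSpace.norm_eq, EuclideanSpace.norm_eq]
  congr 1
  simp [Fin.sum_univ_two, rotVec]
  linear_combination (v 0 ^ 2 + v 1 ^ 2) * sin_sq_add_cos_sq α

lemma rotVec_two_pi (v : EuclideanSpace ℝ (Fin 2)) : rotVec (2 * π) v = v := by
  ext i
  fin_cases i <;> simp [rotVec]

end

theorem stmt15 (B : Set (EuclideanSpace ℝ (Fin 2))) (S : Set (Set (EuclideanSpace ℝ (Fin 2))))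
    (hpoly : IsPolygonal B S) (hC3 : C3 B)
    (A : EuclideanSpace ℝ (Fin 2)) (hA : Feasible B S A) :
    ∀ P : EuclideanSpace ℝ (Fin 2), dist A P = 1 →
      (P ∈ frontier B ↔ A + rotVec (π / 3) (P - A) ∈ frontier B) := by
  intro P hP
  refine ⟨hA.rotate_mem_frontier hpoly hC3 hP, fun h => ?_⟩
  have hnorm : ‖P - A‖ = 1 := by rw [← dist_eq_norm, dist_comm, hP]
  have step : ∀ α : ℝ, A + rotVec α (P - A) ∈ frontier B →
      A + rotVec (π / 3 + α) (P - A) ∈ frontier B := by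
    intro α hα
    have := hA.rotate_mem_frontier hpoly hC3 (by simp [dist_eq_norm, norm_rotVec, hnorm]) hα
    rwa [add_sub_cancel_left, rotVec_add] at this
  have h6 := step _ (step _ (step _ (step _ (step _ h))))
  rwa [show π / 3 + (π / 3 + (π / 3 + (π / 3 + (π / 3 + π / 3)))) = 2 * π by ring,
    rotVec_two_pi, add_sub_cancel] at h6

end
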